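/- In the *-algebra O_q(H(2)) with generators z = z*, w, v = w*, the elements T = qz + q^{-1}u and D = uz − q^{-2}vw are central, where u satisfies the relations below; moreover from the relations zw = q²wz, vz = q²zv, q^{-2}vw = −D + qTz − q²z², q^{-2}wv = −D + q^{-1}Tz − q^{-2}z² (with D, T central and self-adjoint) it follows that in any irreducible bounded *-representation π on a Hilbert space with π(z) ≠ 0, the operator π(z) has an eigenvector ξ with π(v)ξ = 0. -/

import Mathlib

theorem oq_mul_apply {H : Type*} [NormedAddCommGroup H] [InnerProductSpace ℂ H]
    (a b : H →L[ℂ] H) (x : H) : (a * b) x = a (b x) := rfl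

theorem oq_cfc_ne {H : Type*} [NormedAddCommGroup H] [InnerProductSpace ℂ H] [CompleteSpace H]
    (a : H →L[ℂ] H) (ha : IsSelfAdjoint a) (f : ℝ → ℝ) (hf : Continuous f)
    (r : ℝ) (hr : r ∈ spectrum ℝ a) (h0 : cfc f a = 0) : f r = 0 := by
  have : Nontrivial (H →L[ℂ] H) := by
    by_contra h
    rw [not_nontrivial_iff_subsingleton] at h
    simp [spectrum.of_subsingleton] at hr
  have h := cfc_map_spectrum (R := ℝ) (a := a) f ha hf.continuousOn
  rw [h0, spectrum.zero_eq] at h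
  have : f r ∈ ({0} : Set ℝ) := by rw [h]; exact ⟨r, hr, rfl⟩
  simpa using this

theorem oq_schur {H : Type*} [NormedAddCommGroup H] [InnerProductSpace ℂ H] [CompleteSpace H]
    [Nontrivial H]
    (a : H →L[ℂ] H) (ha : IsSelfAdjoint a)
    (hS : ∀ S : Submodule ℂ H, IsClosed (S : Set H) →
      (∀ b : H →L[ℂ] H, Commute a b → ∀ x ∈ S, b x ∈ S) → S = ⊥ ∨ S = ⊤) :
    ∃ r : ℝ, a = algebraMap ℝ (H →L[ℂ] H) r := by
  have hne : (spectrum ℝ a).Nonempty := ha.spectrum_nonempty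
  obtain ⟨r, hr⟩ := hne
  refine ⟨r, ?_⟩
  have hsub : ∀ s ∈ spectrum ℝ a, s = r := by
    intro s hs
    by_contra hsr
    set c : ℝ := |s - r| / 2 with hc
    have hpos : 0 < |s - r| := abs_pos.2 (sub_ne_zero.2 hsr)
    let f : ℝ → ℝ := fun x => max (c - |x - r|) 0
    let g : ℝ → ℝ := fun x => max (c - |x - s|) 0
    have hfc : Continuous f := by fun_prop
    have hgc : Continuous g := by fun_prop
    have hfg : ∀ x, f x * g x = 0 := by
      intro x
      rcases le_total c |x - r| with h | h
      · have : f x = 0 := max_eq_right (by linarith)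
        simp [this]
      · have : g x = 0 := by
          refine max_eq_right ?_
          have := abs_sub_le s x r
          rw [abs_sub_comm s x] at this
          linarith
        simp [this]
    have hmul : cfc f a * cfc g a = 0 := by
      rw [← cfc_mul f g a hfc.continuousOn hgc.continuousOn]
      simp [hfg]
    rcases hS (LinearMap.ker (cfc f a).toLinearMap) (cfc f a).isClosed_ker
      (by
        intro b hb x hx
        have hb' : Commute (cfc f a) b := ha.commute_cfc hb f
        have h := congrArg (fun T : H →L[ℂ] H => T x) hb'.eq
        simp only [LinearMap.mem_ker, ContinuousLinearMap.coe_coe,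
          oq_mul_apply] at hx h ⊢
        rw [h, hx, map_zero]) with h | h
    · have : cfc g a = 0 := by
        ext x
        have hx : cfc g a x ∈ LinearMap.ker (cfc f a).toLinearMap := by
          have h := congrArg (fun T : H →L[ℂ] H => T x) hmul
          simpa using h
        rw [h] at hx
        simpa using hx
      have := oq_cfc_ne a ha g hgc s hs this
      have h2 : 0 < g s := by simp only [g]; apply lt_max_of_lt_left; simp; linarith
      linarith
    · have : cfc f a = 0 := by
        ext x
        have hx : x ∈ LinearMap.ker (cfc f a).toLinearMap := by rw [h]; trivial
        simpa using hx
      have := oq_cfc_ne a ha f hfc r hr this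
      have h2 : 0 < f r := by simp only [f]; apply lt_max_of_lt_left; simp; linarith
      linarith
  conv_lhs => rw [← cfc_id ℝ a]
  rw [← cfc_const r a]
  exact cfc_congr fun s hs => hsub s hs

/-- Spectrum shift: pure algebra. -/
theorem oq_shift {A : Type*} [Ring A] [StarRing A] [Algebra ℝ A] [StarModule ℝ A]
    (z w v : A) (k b e : ℝ) (hk : k ≠ 0) (hz : IsSelfAdjoint z)
    (h2 : v * z = k • (z * v))
    (h4 : w * v = algebraMap ℝ A e + b • z - z * z)
    (m : ℝ) (hm : m ∈ spectrum ℝ z) (hm2 : k⁻¹ * m ∉ spectrum ℝ z) :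
    e + b * m - m * m = 0 := by
  by_contra hp
  set p := e + b * m - m * m with hpdef
  rw [spectrum.notMem_iff] at hm2
  rw [spectrum.mem_iff] at hm
  apply hm
  obtain ⟨u, hu⟩ := hm2
  set R : A := ((u⁻¹ : Aˣ) : A) with hR
  have hRu : R * (algebraMap ℝ A (k⁻¹ * m) - z) = 1 := by rw [← hu]; simp [hR]
  set y : A := algebraMap ℝ A m - z with hy
  have hvy : v * y = k • ((algebraMap ℝ A (k⁻¹ * m) - z) * v) := by
    rw [hy, mul_sub, h2, sub_mul, smul_sub, Algebra.algebraMap_eq_smul_one,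
      Algebra.algebraMap_eq_smul_one]
    simp [smul_smul, hk]
  have hkv : R * v * y = k • v := by
    rw [mul_assoc, hvy, mul_smul_comm, ← mul_assoc, hRu, one_mul]
  have hwv : w * v = (k⁻¹ • (w * R * v)) * y := by
    rw [smul_mul_assoc, mul_assoc, mul_assoc, ← mul_assoc R, hkv, mul_smul_comm, smul_smul,
      inv_mul_cancel₀ hk, one_smul]
  have hfac : algebraMap ℝ A e + b • z - z * z
      = p • (1 : A) - ((b - m) • (1 : A) - z) * y := by
    rw [hy, hpdef]
    simp only [Algebra.algebraMap_eq_smul_one, mul_sub, sub_mul, smul_mul_assoc, one_mul,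
      mul_smul_comm, mul_one, smul_smul]
    module
  have hL : (p⁻¹ • (k⁻¹ • (w * R * v) + ((b - m) • (1 : A) - z))) * y = 1 := by
    rw [smul_mul_assoc, add_mul, ← hwv, h4, hfac, sub_add_cancel, smul_smul,
      inv_mul_cancel₀ hp, one_smul]
  have hys : star y = y := by
    rw [hy, star_sub, hz.star_eq, Algebra.algebraMap_eq_smul_one, star_smul, star_one]
    simp
  have hR' := congrArg star hL
  rw [star_mul, hys, star_one] at hR'
  exact isUnit_iff_exists_and_exists.2 ⟨⟨_, hR'⟩, ⟨_, hL⟩⟩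

/-- In any irreducible bounded `*`-representation of `O_q(H(2))` (modelled here by
bounded operators `z = z*`, `w`, `v = w*` and central self-adjoint `t`, `d` on a Hilbert
space satisfying the defining relations) in which `z ≠ 0`, the operator `z` has an
eigenvector `ξ` with `v ξ = 0`. -/
theorem OqH2_irreducible_has_highest_weight_vector
    (q : ℝ) (hq0 : 0 < q) (hq1 : q < 1)
    (H : Type*) [NormedAddCommGroup H] [InnerProductSpace ℂ H] [CompleteSpace H]
    (z w v t d : H →L[ℂ] H)
    (hz : IsSelfAdjoint z) (ht : IsSelfAdjoint t) (hd : IsSelfAdjoint d)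
    (hv : v = ContinuousLinearMap.adjoint w)
    (htz : Commute t z) (htw : Commute t w) (hdz : Commute d z) (hdw : Commute d w)
    (h1 : z * w = ((q : ℂ) ^ 2) • (w * z))
    (h2 : v * z = ((q : ℂ) ^ 2) • (z * v))
    (h3 : (((q : ℂ) ^ 2)⁻¹) • (v * w)
        = -d + (q : ℂ) • (t * z) - ((q : ℂ) ^ 2) • (z * z))
    (h4 : (((q : ℂ) ^ 2)⁻¹) • (w * v)
        = -d + ((q : ℂ)⁻¹) • (t * z) - (((q : ℂ) ^ 2)⁻¹) • (z * z))
    (hirr : ∀ S : Submodule ℂ H, IsClosed (S : Set H) →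
        (∀ x ∈ S, z x ∈ S ∧ w x ∈ S ∧ v x ∈ S ∧ t x ∈ S ∧ d x ∈ S) →
        S = ⊥ ∨ S = ⊤)
    (hz0 : z ≠ 0) :
    ∃ ξ : H, ξ ≠ 0 ∧ (∃ c : ℂ, z ξ = c • ξ) ∧ v ξ = 0 := by
  have hnt : Nontrivial H := by
    by_contra h
    rw [not_nontrivial_iff_subsingleton] at h
    exact hz0 (Subsingleton.elim _ _)
  have hqc : (q : ℂ) ≠ 0 := by exact_mod_cast hq0.ne'
  have hstar : v = star w := hv
  have htv : Commute t v := by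
    have := htw.star_star
    rwa [ht.star_eq, ← hstar] at this
  have hdv : Commute d v := by
    have := hdw.star_star
    rwa [hd.star_eq, ← hstar] at this
  have hdt : Commute t d := by
    have e : d = (q : ℂ) • (t * z) - ((q : ℂ) ^ 2) • (z * z) - (((q : ℂ) ^ 2)⁻¹) • (v * w) := by
      rw [h3]; abel
    rw [e]
    exact ((((Commute.refl t).mul_right htz).smul_right _).sub_right
      ((htz.mul_right htz).smul_right _)).sub_right ((htv.mul_right htw).smul_right _)
  obtain ⟨T, hT⟩ := oq_schur t ht (fun S hS hb => hirr S hS (fun x hx =>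
    ⟨hb z htz x hx, hb w htw x hx, hb v htv x hx, hb t (Commute.refl t) x hx, hb d hdt x hx⟩))
  obtain ⟨D, hD⟩ := oq_schur d hd (fun S hS hb => hirr S hS (fun x hx =>
    ⟨hb z hdz x hx, hb w hdw x hx, hb v hdv x hx, hb t hdt.symm x hx, hb d (Commute.refl d) x hx⟩))
  have hwv : w * v = algebraMap ℝ (H →L[ℂ] H) (-(q ^ 2 * D)) + (q * T) • z - z * z := by
    have e : w * v = ((q : ℂ) ^ 2) • ((((q : ℂ) ^ 2)⁻¹) • (w * v)) := by
      rw [smul_smul, mul_inv_cancel₀ (pow_ne_zero 2 hqc), one_smul]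
    rw [e, h4, hT, hD]
    ext x
    simp only [Algebra.algebraMap_eq_smul_one, ← Complex.coe_smul, smul_mul_assoc, one_mul,
      ContinuousLinearMap.smul_apply, ContinuousLinearMap.add_apply,
      ContinuousLinearMap.sub_apply, ContinuousLinearMap.neg_apply, ContinuousLinearMap.one_apply]
    push_cast
    match_scalars <;> field_simp
  have h2' : v * z = (q ^ 2) • (z * v) := by
    rw [h2, ← Complex.coe_smul]; push_cast; rfl
  -- the spectral point of maximal absolute value
  have hcomp : IsCompact (spectrum ℝ z) := spectrum.isCompact z
  obtain ⟨l, hl, hmax⟩ := hcomp.exists_isMaxOn hz.spectrum_nonempty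
    (continuous_abs.continuousOn)
  have hmax' : ∀ x ∈ spectrum ℝ z, |x| ≤ |l| := fun x hx => hmax hx
  have hl0 : 0 < |l| := by
    by_contra h
    apply hz0
    rw [← cfc_id ℝ z, ← cfc_zero ℝ z]
    refine cfc_congr fun x hx => ?_
    have := hmax' x hx
    have h3 : |x| = 0 := le_antisymm (by linarith) (abs_nonneg x)
    simpa using h3
  let g : ℝ → ℝ := fun x => max (|x| - q ^ 2 * |l|) 0
  have hgc : Continuous g := by fun_prop
  have hq2 : q ^ 2 < 1 := by nlinarith
  have hG : cfc g z ≠ 0 := by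
    intro h
    have h5 := oq_cfc_ne z hz g hgc l hl h
    have : 0 < g l := by
      apply lt_max_of_lt_left; nlinarith
    linarith
  let p : ℝ → ℝ := fun x => -(q ^ 2 * D) + (q * T) * x - x * x
  have hpc : Continuous p := by fun_prop
  have hpz : cfc p z = w * v := by
    rw [hwv]
    rw [cfc_sub (a := z) (fun x => -(q ^ 2 * D) + (q * T) * x) (fun x => x * x),
      cfc_add (a := z) (fun x => -(q ^ 2 * D)) (fun x => (q * T) * x),
      cfc_const _ z, cfc_const_mul _ _ z, cfc_mul _ _ z, cfc_id' ℝ z]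
  have hpg : cfc p z * cfc g z = 0 := by
    rw [← cfc_mul p g z hpc.continuousOn hgc.continuousOn, ← cfc_zero ℝ z]
    refine cfc_congr fun x hx => ?_
    change p x * g x = 0
    rcases le_or_gt |x| (q ^ 2 * |l|) with h | h
    · have : g x = 0 := max_eq_right (by linarith)
      simp [this]
    · have : p x = 0 := by
        refine oq_shift z w v (q ^ 2) _ _ (by positivity) hz h2' hwv x hx ?_
        intro hx2
        have := hmax' _ hx2
        rw [abs_mul, abs_of_pos (by positivity), inv_mul_le_iff₀ (by positivity)] at this
        linarith
      simp [this]
  obtain ⟨x, hx⟩ : ∃ x, cfc g z x ≠ 0 := by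
    by_contra! h
    exact hG (ContinuousLinearMap.ext h)
  set y := cfc g z x with hy
  have hwvy : w (v y) = 0 := by
    rw [hpz] at hpg
    exact congrArg (fun S : H →L[ℂ] H => S x) hpg
  have hvy : v y = 0 := by
    have : inner ℂ (v y) (v y) = 0 := by
      nth_rewrite 1 [hv]
      rw [ContinuousLinearMap.adjoint_inner_left, hwvy, inner_zero_right]
    simpa using this
  obtain ⟨s, hs⟩ := IsAlgClosed.exists_pow_nat_eq
    (((q : ℂ) * T) ^ 2 - 4 * ((q : ℂ) ^ 2 * D)) (n := 2) (by norm_num)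
  have hquad : z (z y) = ((q : ℂ) * T) • z y - ((q : ℂ) ^ 2 * D) • y := by
    have h := congrArg (fun S : H →L[ℂ] H => S y) hwv
    simp only [Algebra.algebraMap_eq_smul_one, ← Complex.coe_smul,
      ContinuousLinearMap.smul_apply, ContinuousLinearMap.add_apply,
      ContinuousLinearMap.sub_apply, ContinuousLinearMap.one_apply,
      oq_mul_apply, hwvy] at h
    have h' := (sub_eq_zero.1 h.symm).symm
    rw [h']
    push_cast
    module
  by_cases h : z y = (((q : ℂ) * T + s) / 2) • y
  · exact ⟨y, hx, ⟨_, h⟩, hvy⟩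
  · refine ⟨z y - (((q : ℂ) * T + s) / 2) • y, sub_ne_zero.2 h, ⟨((q : ℂ) * T - s) / 2, ?_⟩, ?_⟩
    · rw [map_sub, map_smul, hquad]
      have hD' : (q : ℂ) ^ 2 * D = (((q : ℂ) * T) ^ 2 - s ^ 2) / 4 := by rw [hs]; ring
      rw [hD']
      module
    · have h6 := congrArg (fun S : H →L[ℂ] H => S y) h2
      simp only [ContinuousLinearMap.smul_apply, oq_mul_apply, hvy, map_zero,
        smul_zero] at h6
      rw [map_sub, map_smul, h6, hvy, smul_zero, sub_zero]
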